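/- Let F = {D₄, P}, where D₄ is the 4×4 binary matrix with support {(1,1),(2,2),(3,3),(4,4)} and P is the 4×3 binary matrix with support {(1,2),(2,1),(3,2),(4,3)} (rows numbered top to bottom). Then the class Av(F) of binary matrices avoiding both patterns of F as interval minors is row-bounded but not column-bounded. -/

import Mathlib

/-!
Common framework: binary matrices, interval minors, criticality, 0-runs,
row/column complexity, embeddings and related notions, following
Jelínek–Kučera, "On the structure of matrices avoiding interval-minor
patterns". All indices are 0-based.
-/

/-- A binary matrix: dimensions `m × n`, with entries given by a total
function (entries outside the range `[0,m) × [0,n)` are irrelevant: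
all definitions below only inspect in-range entries). -/
structure BMat where
  m : ℕ
  n : ℕ
  entry : ℕ → ℕ → Bool

namespace BMat

/-- The support of a binary matrix: its set of (in-range) 1-entries. -/
def supp (M : BMat) : Set (ℕ × ℕ) :=
  {p | p.1 < M.m ∧ p.2 < M.n ∧ M.entry p.1 p.2 = true}

/-- `M'` is obtained from `M` by contracting two adjacent rows `r`, `r+1`. -/
def RowCon (M M' : BMat) : Prop :=
  ∃ r, r + 1 < M.m ∧ M'.m + 1 = M.m ∧ M'.n = M.n ∧
    ∀ i j, i < M'.m → j < M'.n →
      M'.entry i j =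
        if i < r then M.entry i j
        else if i = r then (M.entry r j || M.entry (r + 1) j)
        else M.entry (i + 1) j

/-- `M'` is obtained from `M` by contracting two adjacent columns `c`, `c+1`. -/
def ColCon (M M' : BMat) : Prop :=
  ∃ c, c + 1 < M.n ∧ M'.n + 1 = M.n ∧ M'.m = M.m ∧
    ∀ i j, i < M'.m → j < M'.n →
      M'.entry i j =
        if j < c then M.entry i j
        else if j = c then (M.entry i c || M.entry i (c + 1))
        else M.entry i (j + 1)

/-- One contraction step (of a row or of a column). -/
def Con (M M' : BMat) : Prop := RowCon M M' ∨ ColCon M M'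

/-- `P` is an interval minor of `M`: `M` can be transformed by a sequence of
row and column contractions into a matrix of the same dimensions as `P`
dominating `P`. -/
def IntervalMinor (P M : BMat) : Prop :=
  ∃ M', Relation.ReflTransGen Con M M' ∧ M'.m = P.m ∧ M'.n = P.n ∧
    ∀ i j, i < P.m → j < P.n → P.entry i j = true → M'.entry i j = true

/-- `M` avoids `P` as an interval minor. -/
def Avoids (P M : BMat) : Prop := ¬ IntervalMinor P M

/-- The class of all matrices avoiding `P` as an interval minor. -/
def Av (P : BMat) : Set BMat := {M | Avoids P M}

/-- The class of all matrices avoiding every pattern of `F` as an interval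
minor. -/
def AvF (F : Set BMat) : Set BMat := {M | ∀ P ∈ F, Avoids P M}

/-- The matrix obtained from `M` by changing the entry at position `(i, j)`
into a 1-entry. -/
def setOne (M : BMat) (i j : ℕ) : BMat :=
  ⟨M.m, M.n, fun a b => if a = i ∧ b = j then true else M.entry a b⟩

/-- `M` is critical for the class `C`: it lies in `C`, but changing any
single 0-entry of `M` into a 1-entry leaves `C`. -/
def CriticalFor (C : Set BMat) (M : BMat) : Prop :=
  M ∈ C ∧ ∀ i j, i < M.m → j < M.n → M.entry i j = false → setOne M i j ∉ C

/-- The number of horizontal 0-runs in row `r` of `M`, counted via their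
starting columns. -/
noncomputable def rowRunCount (M : BMat) (r : ℕ) : ℕ :=
  Set.ncard {j | j < M.n ∧ M.entry r j = false ∧ (j = 0 ∨ M.entry r (j - 1) = true)}

/-- The number of vertical 0-runs in column `c` of `M`. -/
noncomputable def colRunCount (M : BMat) (c : ℕ) : ℕ :=
  Set.ncard {i | i < M.m ∧ M.entry i c = false ∧ (i = 0 ∨ M.entry (i - 1) c = true)}

/-- A class is row-bounded if there is a uniform bound on the number of
0-runs in any row of any matrix that is critical for the class. -/
def RowBounded (C : Set BMat) : Prop :=
  ∃ K, ∀ M, CriticalFor C M → ∀ r, r < M.m → rowRunCount M r ≤ K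

/-- A class is column-bounded if there is a uniform bound on the number of
0-runs in any column of any matrix that is critical for the class. -/
def ColBounded (C : Set BMat) : Prop :=
  ∃ K, ∀ M, CriticalFor C M → ∀ c, c < M.n → colRunCount M c ≤ K

/-- A class is bounded if it is both row-bounded and column-bounded. -/
def Bounded (C : Set BMat) : Prop := RowBounded C ∧ ColBounded C

/-- The pattern `Q₁`, with support `{(1,2),(2,1),(3,3)}` (1-based). -/
def Q1 : BMat :=
  ⟨3, 3, fun i j => (i == 0 && j == 1) || (i == 1 && j == 0) || (i == 2 && j == 2)⟩

/-- The pattern `Q₂`, with support `{(1,2),(2,3),(3,1)}` (1-based). -/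
def Q2 : BMat :=
  ⟨3, 3, fun i j => (i == 0 && j == 1) || (i == 1 && j == 2) || (i == 2 && j == 0)⟩

/-- The pattern `Q₃`, with support `{(1,1),(2,3),(3,2)}` (1-based). -/
def Q3 : BMat :=
  ⟨3, 3, fun i j => (i == 0 && j == 0) || (i == 1 && j == 2) || (i == 2 && j == 1)⟩

/-- The pattern `Q₄`, with support `{(1,3),(2,1),(3,2)}` (1-based). -/
def Q4 : BMat :=
  ⟨3, 3, fun i j => (i == 0 && j == 2) || (i == 1 && j == 0) || (i == 2 && j == 1)⟩

/-- The diagonal pattern `D_k`, with support `{(i,i) : i ∈ [k]}`. -/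
def D (k : ℕ) : BMat := ⟨k, k, fun i j => i == j⟩

/-- The antidiagonal pattern `D̄_k`, with support `{(i, k+1-i) : i ∈ [k]}`
(1-based). -/
def Dbar (k : ℕ) : BMat := ⟨k, k, fun i j => i + j + 1 == k⟩

/-- An embedding of `P` into `M`: 1-entries go to 1-entries, and the map is
strictly monotone in rows and in columns. -/
def IsEmbedding (P M : BMat) (φ : ℕ → ℕ → ℕ × ℕ) : Prop :=
  (∀ i j, i < P.m → j < P.n → (φ i j).1 < M.m ∧ (φ i j).2 < M.n) ∧
  (∀ i j, i < P.m → j < P.n → P.entry i j = true →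
      M.entry (φ i j).1 (φ i j).2 = true) ∧
  (∀ i₁ j₁ i₂ j₂, i₁ < P.m → j₁ < P.n → i₂ < P.m → j₂ < P.n →
      (i₁ < i₂ → (φ i₁ j₁).1 < (φ i₂ j₂).1) ∧
      (j₁ < j₂ → (φ i₁ j₁).2 < (φ i₂ j₂).2))

/-- A partition of `M` containing `P` (via row indices `r 0 < ⋯ < r P.m ≤ M.m`
and column indices `c 0 < ⋯ < c P.n ≤ M.n`). -/
def PartitionContains (M P : BMat) : Prop :=
  ∃ r c : ℕ → ℕ,
    (∀ i, i < P.m → r i < r (i + 1)) ∧ (∀ j, j < P.n → c j < c (j + 1)) ∧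
    r P.m ≤ M.m ∧ c P.n ≤ M.n ∧
    ∀ i j, i < P.m → j < P.n → P.entry i j = true →
      ∃ a b, r i ≤ a ∧ a < r (i + 1) ∧ c j ≤ b ∧ b < c (j + 1) ∧
        M.entry a b = true

/-- A partial embedding of `P` into `M`, defined on a nonempty set `S` of
entries of `P`. -/
def IsPartialEmbedding (P M : BMat) (S : Set (ℕ × ℕ)) (ψ : ℕ × ℕ → ℕ × ℕ) : Prop :=
  S.Nonempty ∧ (∀ e ∈ S, e.1 < P.m ∧ e.2 < P.n) ∧
  (∀ i j, i < P.m → j < P.n → P.entry i j = true →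
      (i, j) ∈ S ∧ M.entry (ψ (i, j)).1 (ψ (i, j)).2 = true) ∧
  (∀ e ∈ S, (ψ e).1 < M.m ∧ (ψ e).2 < M.n ∧
      e.1 ≤ (ψ e).1 ∧ e.2 ≤ (ψ e).2 ∧
      P.m - 1 - e.1 ≤ M.m - 1 - (ψ e).1 ∧ P.n - 1 - e.2 ≤ M.n - 1 - (ψ e).2) ∧
  (∀ e₁ ∈ S, ∀ e₂ ∈ S,
      (e₁.1 < e₂.1 → e₂.1 - e₁.1 ≤ (ψ e₂).1 - (ψ e₁).1) ∧
      (e₁.2 < e₂.2 → e₂.2 - e₁.2 ≤ (ψ e₂).2 - (ψ e₁).2))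

/-- A horizontal 0-run of `M` in row `r`, occupying exactly columns
`c₁, …, c₂`. -/
def ZeroRun (M : BMat) (r c₁ c₂ : ℕ) : Prop :=
  r < M.m ∧ c₁ ≤ c₂ ∧ c₂ < M.n ∧
  (∀ j, c₁ ≤ j → j ≤ c₂ → M.entry r j = false) ∧
  (c₁ = 0 ∨ M.entry r (c₁ - 1) = true) ∧
  (c₂ + 1 = M.n ∨ M.entry r (c₂ + 1) = true)

/-- The 0-entry `f` of `M` is critical for the 1-entry `e` of `P`: some
embedding of `P` into `M △ f` maps `e` to `f`. -/
def CritEntry (P : BMat) (e : ℕ × ℕ) (M : BMat) (f : ℕ × ℕ) : Prop :=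
  f.1 < M.m ∧ f.2 < M.n ∧ M.entry f.1 f.2 = false ∧
  ∃ φ, IsEmbedding P (setOne M f.1 f.2) φ ∧ φ e.1 e.2 = f

/-- The number of horizontal 0-runs in row `r` of `M` that are critical for
the 1-entry `e` of `P` (counted via their starting columns). -/
noncomputable def critRunCount (P : BMat) (e : ℕ × ℕ) (M : BMat) (r : ℕ) : ℕ :=
  Set.ncard {c₁ | ∃ c₂, ZeroRun M r c₁ c₂ ∧
    ∃ c, c₁ ≤ c ∧ c ≤ c₂ ∧ CritEntry P e M (r, c)}

/-- The 1-entry `e` of `P` is row-bounding: every row of every `P`-avoiding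
matrix contains a bounded number of 0-runs critical for `e`. -/
def EntryRowBounding (P : BMat) (e : ℕ × ℕ) : Prop :=
  ∃ K, ∀ M, Avoids P M → ∀ r, critRunCount P e M r ≤ K

/-- An increasing walk from `e` to `e'`: a sequence of positions, each step
moving one column to the right or one row up, with `W` its set of
positions. -/
def IsIncreasingWalk (W : Set (ℕ × ℕ)) (e e' : ℕ × ℕ) : Prop :=
  ∃ (t : ℕ) (f : ℕ → ℕ × ℕ), f 0 = e ∧ f t = e' ∧
    W = {x | ∃ i, i ≤ t ∧ f i = x} ∧
    ∀ i, i < t →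
      ((f (i + 1)).1 = (f i).1 ∧ (f (i + 1)).2 = (f i).2 + 1) ∨
      ((f (i + 1)).1 + 1 = (f i).1 ∧ (f (i + 1)).2 = (f i).2)

/-- All 1-entries of `P` can be covered by at most `k` lines
(rows or columns). -/
def CoveredByLines (P : BMat) (k : ℕ) : Prop :=
  ∃ (R C : Finset ℕ), R.card + C.card ≤ k ∧
    ∀ i j, i < P.m → j < P.n → P.entry i j = true → i ∈ R ∨ j ∈ C

/-- Clockwise rotation by 90 degrees. -/
def rot90 (P : BMat) : BMat := ⟨P.n, P.m, fun i j => P.entry (P.m - 1 - j) i⟩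

/-- Rotation by 180 degrees. -/
def rot180 (P : BMat) : BMat :=
  ⟨P.m, P.n, fun i j => P.entry (P.m - 1 - i) (P.n - 1 - j)⟩

/-- Clockwise rotation by 270 degrees. -/
def rot270 (P : BMat) : BMat := ⟨P.n, P.m, fun i j => P.entry j (P.n - 1 - i)⟩

/-- Reflection turning the matrix upside down (reversing the rows). -/
def reflRows (P : BMat) : BMat := ⟨P.m, P.n, fun i j => P.entry (P.m - 1 - i) j⟩

/-- Reflection reversing the columns. -/
def reflCols (P : BMat) : BMat := ⟨P.m, P.n, fun i j => P.entry i (P.n - 1 - j)⟩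

/-- Reflection along the main diagonal (transposition). -/
def transposeB (P : BMat) : BMat := ⟨P.n, P.m, fun i j => P.entry j i⟩

/-- Reflection along the antidiagonal. -/
def antitransposeB (P : BMat) : BMat :=
  ⟨P.n, P.m, fun i j => P.entry (P.m - 1 - j) (P.n - 1 - i)⟩

/-- Type 1 pattern of Lemma `lem-2types`: rows `r < r' < r''`, columns
`c < c'`, with `supp ⊆ ({r'} × [c,c']) ∪ {(r,c),(r'',c),(r,c'),(r'',c')}`. -/
def TypeOne (P₀ : BMat) : Prop :=
  ∃ r r' r'' c c', r < r' ∧ r' < r'' ∧ r'' < P₀.m ∧ c < c' ∧ c' < P₀.n ∧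
    ∀ i j, i < P₀.m → j < P₀.n → P₀.entry i j = true →
      (i = r' ∧ c ≤ j ∧ j ≤ c') ∨ ((i = r ∨ i = r'') ∧ (j = c ∨ j = c'))

/-- Type 2 pattern of Lemma `lem-2types`: rows `r < r'`, columns `c < c'`,
with `supp ⊆ ({r} × [c,c']) ∪ ({r'} × [1,c]) ∪ ([1,r] × {c'}) ∪ {(r',c')}`. -/
def TypeTwo (P₀ : BMat) : Prop :=
  ∃ r r' c c', r < r' ∧ r' < P₀.m ∧ c < c' ∧ c' < P₀.n ∧
    ∀ i j, i < P₀.m → j < P₀.n → P₀.entry i j = true →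
      (i = r ∧ c ≤ j ∧ j ≤ c') ∨ (i = r' ∧ j ≤ c) ∨ (i ≤ r ∧ j = c') ∨
      (i = r' ∧ j = c')

/-- A minor-closed class of binary matrices. -/
def MinorClosed (C : Set BMat) : Prop :=
  ∀ M ∈ C, ∀ P, IntervalMinor P M → P ∈ C

/-- The 4×3 pattern with support `{(1,2),(2,1),(3,2),(4,3)}` (1-based), from
Proposition `pro-counter`. -/
def P18 : BMat :=
  ⟨4, 3, fun i j => (i == 0 && j == 1) || (i == 1 && j == 0) ||
    (i == 2 && j == 1) || (i == 3 && j == 2)⟩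

end BMat

namespace BMat

/-- In-range 1-entry. -/
def E (M : BMat) (i j : ℕ) : Prop := i < M.m ∧ j < M.n ∧ M.entry i j = true

/-- Order-preserving map on 1-entries. -/
def Emb (A B : BMat) : Prop :=
  ∃ φ ψ : ℕ → ℕ → ℕ, (∀ i j, E A i j → E B (φ i j) (ψ i j)) ∧
    ∀ i j i' j', E A i j → E A i' j' →
      (i < i' → φ i j < φ i' j') ∧ (j < j' → ψ i j < ψ i' j')

theorem Emb.trans' {A B C : BMat} (h1 : Emb A B) (h2 : Emb B C) : Emb A C := by
  obtain ⟨f, g, h, k⟩ := h1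
  obtain ⟨f', g', h', k'⟩ := h2
  refine ⟨fun i j => f' (f i j) (g i j), fun i j => g' (f i j) (g i j),
    fun i j e => h' _ _ (h _ _ e), fun i j i' j' e e' => ?_⟩
  have := k i j i' j' e e'
  have := k' _ _ _ _ (h _ _ e) (h _ _ e')
  tauto

theorem emb_of_con {M M' : BMat} (h : Con M M') : Emb M' M := by
  rcases h with ⟨r, hr, hm, hn, he⟩ | ⟨r, hr, hm, hn, he⟩
  · refine ⟨fun i j => if i < r then i else if i = r then
      (if M.entry r j = true then r else r + 1) else i + 1, fun i j => j, ?_, ?_⟩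
    · rintro i j ⟨h1, h2, h3⟩
      rw [he i j h1 h2] at h3
      unfold E
      dsimp only
      split_ifs at h3 ⊢ with a b c
      · exact ⟨by omega, by omega, h3⟩
      · exact ⟨by omega, by omega, c⟩
      · exact ⟨by omega, by omega, by simpa [c] using h3⟩
      · exact ⟨by omega, by omega, h3⟩
    · intro i j i' j' _ _
      dsimp only
      refine ⟨fun h => ?_, fun h => h⟩
      split_ifs <;> omega
  · refine ⟨fun i j => i, fun i j => if j < r then j else if j = r then
      (if M.entry i r = true then r else r + 1) else j + 1, ?_, ?_⟩
    · rintro i j ⟨h1, h2, h3⟩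
      rw [he i j h1 h2] at h3
      unfold E
      dsimp only
      split_ifs at h3 ⊢ with a b c
      · exact ⟨by omega, by omega, h3⟩
      · exact ⟨by omega, by omega, c⟩
      · exact ⟨by omega, by omega, by simpa [c] using h3⟩
      · exact ⟨by omega, by omega, h3⟩
    · intro i j i' j' _ _
      dsimp only
      refine ⟨fun h => h, fun h => ?_⟩
      split_ifs <;> omega

theorem emb_of_minor {P M : BMat} (h : IntervalMinor P M) : Emb P M := by
  obtain ⟨M', h, hm, hn, hd⟩ := h
  have h1 : Emb M' M := by
    clear hm hn hd
    induction h with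
    | refl => exact ⟨fun i _ => i, fun _ j => j, fun _ _ h => h, fun _ _ _ _ _ _ => ⟨id, id⟩⟩
    | tail _ h ih => exact (emb_of_con h).trans' ih
  refine Emb.trans' ⟨fun i _ => i, fun _ j => j, fun i j h => ?_, fun _ _ _ _ _ _ => ⟨id, id⟩⟩ h1
  exact ⟨hm ▸ h.1, hn ▸ h.2.1, hd i j h.1 h.2.1 h.2.2⟩

/-- `ρ` splits `[0,m)` into `k` consecutive nonempty intervals. -/
def Blk (ρ : ℕ → ℕ) (m k : ℕ) : Prop :=
  0 < m ∧ ρ 0 = 0 ∧ ρ (m - 1) + 1 = k ∧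
    ∀ a, a + 1 < m → ρ (a + 1) = ρ a ∨ ρ (a + 1) = ρ a + 1

theorem blk_id {ρ : ℕ → ℕ} {m k : ℕ} (h : Blk ρ m k)
    (hn : ¬ ∃ a, a + 1 < m ∧ ρ (a + 1) = ρ a) : m = k ∧ ∀ a, a < m → ρ a = a := by
  obtain ⟨h0, h1, h2, h3⟩ := h
  have key : ∀ a, a < m → ρ a = a := by
    intro a
    induction a with
    | zero => intro _; exact h1
    | succ a ih =>
      intro ha
      have := ih (by omega)
      rcases h3 a ha with h | h
      · exact absurd ⟨a, ha, h⟩ hn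
      · omega
  have := key (m - 1) (by omega)
  exact ⟨by omega, key⟩

theorem blk_con {ρ : ℕ → ℕ} {m k a : ℕ} (h : Blk ρ m k) (ha : a + 1 < m)
    (hρ : ρ (a + 1) = ρ a) : Blk (fun i => if i ≤ a then ρ i else ρ (i + 1)) (m - 1) k := by
  obtain ⟨h0, h1, h2, h3⟩ := h
  refine ⟨by omega, by simp [h1], ?_, ?_⟩
  · dsimp only
    split_ifs with hh
    · have e1 : a = m - 1 - 1 := by omega
      have e2 : m - 1 = a + 1 := by omega
      rw [← e1, ← hρ, ← e2]; exact h2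
    · rw [show m - 1 - 1 + 1 = m - 1 by omega]; exact h2
  · intro i hi
    dsimp only
    split_ifs with p q q
    · exact h3 i (by omega)
    · omega
    · have : i = a := by omega
      subst this
      have := h3 (i + 1) (by omega)
      rwa [hρ] at this
    · exact h3 (i + 1) (by omega)

theorem minor_of_blk (P : BMat) : ∀ (N : ℕ) (M : BMat) (ρ γ : ℕ → ℕ), M.m + M.n = N →
    Blk ρ M.m P.m → Blk γ M.n P.n →
    (∀ i j, i < P.m → j < P.n → P.entry i j = true → ∃ a b, E M a b ∧ ρ a = i ∧ γ b = j) →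
    IntervalMinor P M := by
  intro N
  induction N with
  | zero =>
    intro M ρ γ hN h1 h2 _
    have := h1.1
    omega
  | succ N ih =>
    intro M ρ γ hN h1 h2 h3
    by_cases hr : ∃ a, a + 1 < M.m ∧ ρ (a + 1) = ρ a
    · obtain ⟨r, hr, hρ⟩ := hr
      let M' : BMat := ⟨M.m - 1, M.n, fun i j => if i < r then M.entry i j
        else if i = r then (M.entry r j || M.entry (r + 1) j) else M.entry (i + 1) j⟩
      have hc : Con M M' := Or.inl ⟨r, hr, by simp only [M']; omega, rfl, fun i j _ _ => rfl⟩
      obtain ⟨M'', hq, hh⟩ := ih M' _ γ (by simp only [M']; omega) (blk_con h1 hr hρ) h2 (by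
        intro i j hi hj hp
        obtain ⟨a, b, ⟨ha, hb, he⟩, hρa, hγ⟩ := h3 i j hi hj hp
        refine ⟨if a ≤ r then a else a - 1, b, ⟨?_, hb, ?_⟩, ?_, hγ⟩
        · simp only [M']; split_ifs <;> omega
        · simp only [M']
          rcases lt_trichotomy a r with h | h | h
          · rw [if_pos h.le, if_pos h]; exact he
          · subst h; simp [he]
          · rw [if_neg (by omega : ¬ a ≤ r), if_neg (by omega : ¬ a - 1 < r)]
            split_ifs with h'
            · have : a = r + 1 := by omega
              subst this; simp [he]
            · rw [show a - 1 + 1 = a by omega]; exact he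
        · rcases lt_trichotomy a (r + 1) with h | h | h
          · rw [if_pos (by omega : a ≤ r), if_pos (by omega : a ≤ r)]; exact hρa
          · subst h; simp [← hρ, hρa]
          · rw [if_neg (by omega : ¬ a ≤ r), if_neg (by omega : ¬ a - 1 ≤ r),
              show a - 1 + 1 = a by omega]; exact hρa)
      exact ⟨M'', Relation.ReflTransGen.head hc hq, hh⟩
    by_cases hs : ∃ a, a + 1 < M.n ∧ γ (a + 1) = γ a
    · obtain ⟨r, hr, hρ⟩ := hs
      let M' : BMat := ⟨M.m, M.n - 1, fun i j => if j < r then M.entry i j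
        else if j = r then (M.entry i r || M.entry i (r + 1)) else M.entry i (j + 1)⟩
      have hc : Con M M' := Or.inr ⟨r, hr, by simp only [M']; omega, rfl, fun i j _ _ => rfl⟩
      obtain ⟨M'', hq, hh⟩ := ih M' ρ _ (by simp only [M']; omega) h1 (blk_con h2 hr hρ) (by
        intro i j hi hj hp
        obtain ⟨b, a, ⟨hb, ha, he⟩, hγ, hρa⟩ := h3 i j hi hj hp
        refine ⟨b, if a ≤ r then a else a - 1, ⟨hb, ?_, ?_⟩, hγ, ?_⟩
        · simp only [M']; split_ifs <;> omega
        · simp only [M']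
          rcases lt_trichotomy a r with h | h | h
          · rw [if_pos h.le, if_pos h]; exact he
          · subst h; simp [he]
          · rw [if_neg (by omega : ¬ a ≤ r), if_neg (by omega : ¬ a - 1 < r)]
            split_ifs with h'
            · have : a = r + 1 := by omega
              subst this; simp [he]
            · rw [show a - 1 + 1 = a by omega]; exact he
        · rcases lt_trichotomy a (r + 1) with h | h | h
          · rw [if_pos (by omega : a ≤ r), if_pos (by omega : a ≤ r)]; exact hρa
          · subst h; simp [← hρ, hρa]
          · rw [if_neg (by omega : ¬ a ≤ r), if_neg (by omega : ¬ a - 1 ≤ r),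
              show a - 1 + 1 = a by omega]; exact hρa)
      exact ⟨M'', Relation.ReflTransGen.head hc hq, hh⟩
    obtain ⟨e1, i1⟩ := blk_id h1 hr
    obtain ⟨e2, i2⟩ := blk_id h2 hs
    refine ⟨M, Relation.ReflTransGen.refl, e1, e2, fun i j hi hj hp => ?_⟩
    obtain ⟨a, b, ⟨ha, hb, he⟩, hρ, hγ⟩ := h3 i j hi hj hp
    rw [i1 a ha] at hρ
    rw [i2 b hb] at hγ
    subst hρ hγ
    exact he

theorem D4_iff (M : BMat) : IntervalMinor (D 4) M ↔
    ∃ r0 r1 r2 r3 c0 c1 c2 c3, E M r0 c0 ∧ E M r1 c1 ∧ E M r2 c2 ∧ E M r3 c3 ∧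
      r0 < r1 ∧ r1 < r2 ∧ r2 < r3 ∧ c0 < c1 ∧ c1 < c2 ∧ c2 < c3 := by
  constructor
  · intro h
    obtain ⟨f, g, h, k⟩ := emb_of_minor h
    have e : ∀ i, i < 4 → E (D 4) i i := fun i hi => ⟨hi, hi, by simp [D]⟩
    have e0 := e 0 (by norm_num)
    have e1 := e 1 (by norm_num)
    have e2 := e 2 (by norm_num)
    have e3 := e 3 (by norm_num)
    have k0 := k _ _ _ _ e0 e1
    have k1 := k _ _ _ _ e1 e2
    have k2 := k _ _ _ _ e2 e3
    exact ⟨_, _, _, _, _, _, _, _, h _ _ e0, h _ _ e1, h _ _ e2, h _ _ e3,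
      k0.1 (by norm_num), k1.1 (by norm_num), k2.1 (by norm_num),
      k0.2 (by norm_num), k1.2 (by norm_num), k2.2 (by norm_num)⟩
  · rintro ⟨r0, r1, r2, r3, c0, c1, c2, c3, e0, e1, e2, e3, h1, h2, h3, h4, h5, h6⟩
    refine minor_of_blk _ _ M
      (fun x => if x < r1 then 0 else if x < r2 then 1 else if x < r3 then 2 else 3)
      (fun x => if x < c1 then 0 else if x < c2 then 1 else if x < c3 then 2 else 3) rfl ?_ ?_ ?_
    · have := e3.1
      refine ⟨by omega, ?_, ?_, fun a ha => ?_⟩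
      · simp; omega
      · dsimp only [D]; split_ifs <;> omega
      · dsimp only; split_ifs <;> omega
    · have := e3.2.1
      refine ⟨by omega, ?_, ?_, fun a ha => ?_⟩
      · simp; omega
      · dsimp only [D]; split_ifs <;> omega
      · dsimp only; split_ifs <;> omega
    · intro i j hi hj hp
      simp only [D, beq_iff_eq] at hi hj hp
      subst hp
      interval_cases i
      · exact ⟨_, _, e0, by split_ifs <;> omega, by split_ifs <;> omega⟩
      · exact ⟨_, _, e1, by split_ifs <;> omega, by split_ifs <;> omega⟩
      · exact ⟨_, _, e2, by split_ifs <;> omega, by split_ifs <;> omega⟩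
      · exact ⟨_, _, e3, by split_ifs <;> omega, by split_ifs <;> omega⟩

theorem P18_iff (M : BMat) : IntervalMinor P18 M ↔
    ∃ r0 r1 r2 r3 a b a' c, E M r0 a ∧ E M r1 b ∧ E M r2 a' ∧ E M r3 c ∧
      r0 < r1 ∧ r1 < r2 ∧ r2 < r3 ∧ b < a ∧ b < a' ∧ a < c ∧ a' < c := by
  constructor
  · intro h
    obtain ⟨f, g, h, k⟩ := emb_of_minor h
    have e0 : E P18 0 1 := ⟨by decide, by decide, by decide⟩
    have e1 : E P18 1 0 := ⟨by decide, by decide, by decide⟩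
    have e2 : E P18 2 1 := ⟨by decide, by decide, by decide⟩
    have e3 : E P18 3 2 := ⟨by decide, by decide, by decide⟩
    exact ⟨_, _, _, _, _, _, _, _, h _ _ e0, h _ _ e1, h _ _ e2, h _ _ e3,
      (k _ _ _ _ e0 e1).1 (by norm_num), (k _ _ _ _ e1 e2).1 (by norm_num),
      (k _ _ _ _ e2 e3).1 (by norm_num), (k _ _ _ _ e1 e0).2 (by norm_num),
      (k _ _ _ _ e1 e2).2 (by norm_num), (k _ _ _ _ e0 e3).2 (by norm_num),
      (k _ _ _ _ e2 e3).2 (by norm_num)⟩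
  · rintro ⟨r0, r1, r2, r3, a, b, a', c, e0, e1, e2, e3, h1, h2, h3, h4, h5, h6, h7⟩
    refine minor_of_blk _ _ M
      (fun x => if x < r1 then 0 else if x < r2 then 1 else if x < r3 then 2 else 3)
      (fun x => if x < a ∧ x < a' then 0 else if x < c then 1 else 2) rfl ?_ ?_ ?_
    · have := e3.1
      refine ⟨by omega, ?_, ?_, fun a ha => ?_⟩
      · simp; omega
      · dsimp only [P18]; split_ifs <;> omega
      · dsimp only; split_ifs <;> omega
    · have := e3.2.1
      refine ⟨by omega, ?_, ?_, fun a ha => ?_⟩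
      · simp; omega
      · dsimp only [P18]; split_ifs <;> omega
      · dsimp only; split_ifs <;> omega
    · intro i j hi hj hp
      have hp' : (i = 0 ∧ j = 1) ∨ (i = 1 ∧ j = 0) ∨ (i = 2 ∧ j = 1) ∨ (i = 3 ∧ j = 2) := by
        simp [P18] at hp; tauto
      rcases hp' with ⟨rfl, rfl⟩ | ⟨rfl, rfl⟩ | ⟨rfl, rfl⟩ | ⟨rfl, rfl⟩
      · exact ⟨_, _, e0, by split_ifs <;> omega, by split_ifs <;> omega⟩
      · exact ⟨_, _, e1, by split_ifs <;> omega, by split_ifs <;> omega⟩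
      · exact ⟨_, _, e2, by split_ifs <;> omega, by split_ifs <;> omega⟩
      · exact ⟨_, _, e3, by split_ifs <;> omega, by split_ifs <;> omega⟩

theorem mem_iff (M : BMat) : M ∈ AvF {D 4, P18} ↔
    ¬ IntervalMinor (D 4) M ∧ ¬ IntervalMinor P18 M := by
  simp [AvF, Avoids]

/-! Column part -/

theorem exists_critical (C : Set BMat) : ∀ (N : ℕ) (M : BMat), M ∈ C →
    (((Finset.range M.m) ×ˢ (Finset.range M.n)).filter
      (fun p => M.entry p.1 p.2 = false)).card = N →
    ∃ M', CriticalFor C M' ∧ M'.m = M.m ∧ M'.n = M.n ∧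
      ∀ i j, M.entry i j = true → M'.entry i j = true := by
  intro N
  induction N using Nat.strong_induction_on with
  | _ N ih =>
    intro M hM hN
    by_cases hc : CriticalFor C M
    · exact ⟨M, hc, rfl, rfl, fun _ _ h => h⟩
    · unfold CriticalFor at hc
      push Not at hc
      obtain ⟨i, j, hi, hj, he, hs⟩ := hc hM
      obtain ⟨M', h1, h2, h3, h4⟩ := ih _ (by
        rw [← hN]
        apply Finset.card_lt_card
        rw [Finset.ssubset_iff_of_subset]
        · exact ⟨(i, j), by simp [hi, hj, he], by simp [setOne]⟩
        · intro p hp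
          simp [setOne] at hp ⊢
          tauto) (setOne M i j) hs rfl
      refine ⟨M', h1, h2, h3, fun a b h => h4 a b ?_⟩
      simp [setOne, h]

/-- The block construction. -/
def W (k : ℕ) : BMat := ⟨4 * k, 2 * k + 1, fun i j =>
  decide (
    (i % 4 = 3 ∧ j = 0) ∨ ((i % 4 = 0 ∨ i % 4 = 2) ∧ j + 2 * (i / 4) + 1 = 2 * k) ∨
      (i % 4 = 3 ∧ j + 2 * (i / 4) = 2 * k))⟩

theorem W_E {k i j : ℕ} : E (W k) i j ↔ i < 4 * k ∧
    ((i % 4 = 3 ∧ j = 0) ∨ ((i % 4 = 0 ∨ i % 4 = 2) ∧ j + 2 * (i / 4) + 1 = 2 * k) ∨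
      (i % 4 = 3 ∧ j + 2 * (i / 4) = 2 * k)) := by
  unfold E W
  simp only [decide_eq_true_eq]
  constructor
  · rintro ⟨h1, h2, h3⟩; exact ⟨h1, h3⟩
  · rintro ⟨h1, h3⟩; exact ⟨h1, by omega, h3⟩

theorem W_mem (k : ℕ) : W k ∈ AvF {D 4, P18} := by
  have chain : ∀ r1 r2 c1 c2, E (W k) r1 c1 → E (W k) r2 c2 → r1 < r2 → c1 < c2 → 0 < c1 →
      (r1 % 4 = 0 ∨ r1 % 4 = 2) ∧ r2 % 4 = 3 ∧ r1 / 4 = r2 / 4 := by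
    intro r1 r2 c1 c2 h1 h2 h3 h4 h5
    rw [W_E] at h1 h2
    omega
  rw [mem_iff, D4_iff, P18_iff]
  constructor
  · rintro ⟨r0, r1, r2, r3, c0, c1, c2, c3, e0, e1, e2, e3, h1, h2, h3, h4, h5, h6⟩
    have := chain _ _ _ _ e1 e2 h2 h5 (by omega)
    have := chain _ _ _ _ e2 e3 h3 h6 (by omega)
    omega
  · rintro ⟨r0, r1, r2, r3, a, b, a', c, e0, e1, e2, e3, h1, h2, h3, h4, h5, h6, h7⟩
    have k1 := chain _ _ _ _ e0 e3 (by omega) h6 (by omega)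
    have k2 := chain _ _ _ _ e2 e3 h3 h7 (by omega)
    rw [W_E] at e1
    omega

theorem not_colBounded : ¬ ColBounded (AvF {D 4, P18}) := by
  rintro ⟨K, hK⟩
  obtain ⟨M, hM, hm, hn, hd⟩ := exists_critical _ _ (W (K + 1)) (W_mem _) rfl
  have hm' : M.m = 4 * (K + 1) := hm
  have hn' : M.n = 2 * (K + 1) + 1 := hn
  have up : ∀ i j, E (W (K + 1)) i j → E M i j := fun i j h =>
    ⟨hm ▸ h.1, hn ▸ h.2.1, hd _ _ h.2.2⟩
  have hP := ((mem_iff M).1 hM.1).2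
  rw [P18_iff] at hP
  have hz : ∀ i, i < K + 1 → M.entry (4 * i + 1) 0 = false := by
    intro i hi
    by_contra hc
    have hc : M.entry (4 * i + 1) 0 = true := by simpa using hc
    apply hP
    refine ⟨4 * i, 4 * i + 1, 4 * i + 2, 4 * i + 3, 2 * (K + 1) - 2 * i - 1, 0,
      2 * (K + 1) - 2 * i - 1, 2 * (K + 1) - 2 * i, up _ _ (W_E.2 ?_),
      ⟨by omega, by omega, hc⟩, up _ _ (W_E.2 ?_), up _ _ (W_E.2 ?_), ?_⟩ <;> omega
  have hs : ∀ i, ∃ s, i < K + 1 → (4 * i ≤ s ∧ s ≤ 4 * i + 1 ∧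
      s < M.m ∧ M.entry s 0 = false ∧ (s = 0 ∨ M.entry (s - 1) 0 = true)) := by
    intro i
    by_cases hi : i < K + 1
    · by_cases h : M.entry (4 * i) 0 = true
      · exact ⟨4 * i + 1, fun _ => ⟨by omega, by omega, by omega, hz i hi, Or.inr (by simpa using h)⟩⟩
      · refine ⟨4 * i, fun _ => ⟨by omega, by omega, by omega, by simpa using h, ?_⟩⟩
        rcases Nat.eq_zero_or_pos i with h0 | h0
        · left; omega
        · right
          exact (up (4 * i - 1) 0 (W_E.2 (by omega))).2.2
    · exact ⟨0, fun h => absurd h hi⟩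
  choose s hs using hs
  have hle := hK M hM 0 (by omega)
  unfold colRunCount at hle
  have hcard : ((Finset.range (K + 1)).image s).card = K + 1 := by
    rw [Finset.card_image_of_injOn, Finset.card_range]
    intro a ha b hb hab
    have ha' := hs a (by simpa using ha)
    have hb' := hs b (by simpa using hb)
    have hab' : s a = s b := hab
    omega
  have hsub : (((Finset.range (K + 1)).image s : Finset ℕ) : Set ℕ) ⊆
      {i | i < M.m ∧ M.entry i 0 = false ∧ (i = 0 ∨ M.entry (i - 1) 0 = true)} := by
    intro x hx
    simp only [Finset.coe_image, Set.mem_image, Finset.coe_range, Set.mem_Iio] at hx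
    obtain ⟨i, hi, rfl⟩ := hx
    exact (hs i hi).2.2
  have := Set.ncard_le_ncard hsub ((Set.finite_lt_nat M.m).subset fun x hx => hx.1)
  rw [Set.ncard_coe_finset, hcard] at this
  omega

/-! Row part -/

theorem setOne_E {M : BMat} {r f i j : ℕ} (h : E (setOne M r f) i j) :
    (i = r ∧ j = f) ∨ E M i j := by
  obtain ⟨h1, h2, h3⟩ := h
  simp only [setOne] at h1 h2 h3
  split_ifs at h3 with h
  · exact Or.inl h
  · exact Or.inr ⟨h1, h2, h3⟩

theorem ncard_le_two {T : Set ℕ} (hT : T.Finite)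
    (h : ∀ x y z, x ∈ T → y ∈ T → z ∈ T → x < y → y < z → False) : T.ncard ≤ 2 := by
  by_contra hc
  push Not at hc
  rw [Set.two_lt_ncard_iff hT] at hc
  obtain ⟨a, b, c, ha, hb, hc, h1, h2, h3⟩ := hc
  rcases lt_or_gt_of_ne h1 with h1 | h1 <;> rcases lt_or_gt_of_ne h2 with h2 | h2 <;>
    rcases lt_or_gt_of_ne h3 with h3 | h3 <;>
    first
    | exact h _ _ _ ha hb hc (by assumption) (by assumption)
    | exact h _ _ _ ha hc hb (by assumption) (by assumption)
    | exact h _ _ _ hb ha hc (by assumption) (by assumption)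
    | exact h _ _ _ hb hc ha (by assumption) (by assumption)
    | exact h _ _ _ hc ha hb (by assumption) (by assumption)
    | exact h _ _ _ hc hb ha (by assumption) (by assumption)

/-- The role of a 0-entry `(r,f)`. -/
def Role (M : BMat) (r f : ℕ) : ℕ → Prop
  | 0 => ∃ r1 r2 r3 c1 c2 c3, E M r1 c1 ∧ E M r2 c2 ∧ E M r3 c3 ∧
      r < r1 ∧ r1 < r2 ∧ r2 < r3 ∧ f < c1 ∧ c1 < c2 ∧ c2 < c3
  | 1 => ∃ r0 r2 r3 c0 c2 c3, E M r0 c0 ∧ E M r2 c2 ∧ E M r3 c3 ∧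
      r0 < r ∧ r < r2 ∧ r2 < r3 ∧ c0 < f ∧ f < c2 ∧ c2 < c3
  | 2 => ∃ r0 r1 r3 c0 c1 c3, E M r0 c0 ∧ E M r1 c1 ∧ E M r3 c3 ∧
      r0 < r1 ∧ r1 < r ∧ r < r3 ∧ c0 < c1 ∧ c1 < f ∧ f < c3
  | 3 => ∃ r0 r1 r2 c0 c1 c2, E M r0 c0 ∧ E M r1 c1 ∧ E M r2 c2 ∧
      r0 < r1 ∧ r1 < r2 ∧ r2 < r ∧ c0 < c1 ∧ c1 < c2 ∧ c2 < f
  | 4 => ∃ r1 r2 r3 b a' c, E M r1 b ∧ E M r2 a' ∧ E M r3 c ∧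
      r < r1 ∧ r1 < r2 ∧ r2 < r3 ∧ b < f ∧ b < a' ∧ f < c ∧ a' < c
  | 5 => ∃ r0 r2 r3 a a' c, E M r0 a ∧ E M r2 a' ∧ E M r3 c ∧
      r0 < r ∧ r < r2 ∧ r2 < r3 ∧ f < a ∧ f < a' ∧ a < c ∧ a' < c
  | 6 => ∃ r0 r1 r3 a b c, E M r0 a ∧ E M r1 b ∧ E M r3 c ∧
      r0 < r1 ∧ r1 < r ∧ r < r3 ∧ b < a ∧ b < f ∧ a < c ∧ f < c
  | 7 => ∃ r0 r1 r2 a b a', E M r0 a ∧ E M r1 b ∧ E M r2 a' ∧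
      r0 < r1 ∧ r1 < r2 ∧ r2 < r ∧ b < a ∧ b < a' ∧ a < f ∧ a' < f
  | _ => False

theorem exists_role {M : BMat} {r f : ℕ} (hM : M ∈ AvF {D 4, P18})
    (h : setOne M r f ∉ AvF {D 4, P18}) : ∃ t, t < 8 ∧ Role M r f t := by
  rw [mem_iff, D4_iff, P18_iff] at hM
  rw [mem_iff, not_and_or, not_not, not_not, D4_iff, P18_iff] at h
  rcases h with h | h
  · obtain ⟨r0, r1, r2, r3, c0, c1, c2, c3, e0, e1, e2, e3, h1, h2, h3, h4, h5, h6⟩ := h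
    rcases setOne_E e0 with ⟨rfl, rfl⟩ | k0
    · exact ⟨0, by omega, r1, r2, r3, c1, c2, c3, (setOne_E e1).resolve_left (by omega),
        (setOne_E e2).resolve_left (by omega), (setOne_E e3).resolve_left (by omega), by omega⟩
    rcases setOne_E e1 with ⟨rfl, rfl⟩ | k1
    · exact ⟨1, by omega, r0, r2, r3, c0, c2, c3, k0,
        (setOne_E e2).resolve_left (by omega), (setOne_E e3).resolve_left (by omega), by omega⟩
    rcases setOne_E e2 with ⟨rfl, rfl⟩ | k2
    · exact ⟨2, by omega, r0, r1, r3, c0, c1, c3, k0, k1,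
        (setOne_E e3).resolve_left (by omega), by omega⟩
    rcases setOne_E e3 with ⟨rfl, rfl⟩ | k3
    · exact ⟨3, by omega, r0, r1, r2, c0, c1, c2, k0, k1, k2, by omega⟩
    exact absurd ⟨r0, r1, r2, r3, c0, c1, c2, c3, k0, k1, k2, k3, h1, h2, h3, h4, h5, h6⟩ hM.1
  · obtain ⟨r0, r1, r2, r3, a, b, a', c, e0, e1, e2, e3, h1, h2, h3, h4, h5, h6, h7⟩ := h
    rcases setOne_E e0 with ⟨rfl, rfl⟩ | k0
    · exact ⟨4, by omega, r1, r2, r3, b, a', c, (setOne_E e1).resolve_left (by omega),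
        (setOne_E e2).resolve_left (by omega), (setOne_E e3).resolve_left (by omega), by omega⟩
    rcases setOne_E e1 with ⟨rfl, rfl⟩ | k1
    · exact ⟨5, by omega, r0, r2, r3, a, a', c, k0,
        (setOne_E e2).resolve_left (by omega), (setOne_E e3).resolve_left (by omega), by omega⟩
    rcases setOne_E e2 with ⟨rfl, rfl⟩ | k2
    · exact ⟨6, by omega, r0, r1, r3, a, b, c, k0, k1,
        (setOne_E e3).resolve_left (by omega), by omega⟩
    rcases setOne_E e3 with ⟨rfl, rfl⟩ | k3
    · exact ⟨7, by omega, r0, r1, r2, a, b, a', k0, k1, k2, by omega⟩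
    exact absurd ⟨r0, r1, r2, r3, a, b, a', c, k0, k1, k2, k3, h1, h2, h3, h4, h5, h6, h7⟩ hM.2

theorem role_three {M : BMat} (hM : M ∈ AvF {D 4, P18}) {r x g y g' z t : ℕ}
    (hg : E M r g) (hg' : E M r g') (h1 : x < g) (h2 : g < y) (h3 : y < g') (h4 : g' < z)
    (hx : Role M r x t) (hy : Role M r y t) (hz : Role M r z t) : False := by
  rw [mem_iff, D4_iff, P18_iff] at hM
  obtain ⟨hD, hP⟩ := hM
  match t with
  | 0 =>
    obtain ⟨r1, r2, r3, c1, c2, c3, e1, e2, e3, h⟩ := hy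
    exact hD ⟨r, r1, r2, r3, g, c1, c2, c3, hg, e1, e2, e3, by omega⟩
  | 1 =>
    obtain ⟨r0, _, _, c0, _, _, e0, _, _, h⟩ := hx
    obtain ⟨_, r2, r3, _, c2, c3, _, e2, e3, h'⟩ := hy
    exact hD ⟨r0, r, r2, r3, c0, g, c2, c3, e0, hg, e2, e3, by omega⟩
  | 2 =>
    obtain ⟨r0, r1, _, c0, c1, _, e0, e1, _, h⟩ := hx
    obtain ⟨_, _, r3, _, _, c3, _, _, e3, h'⟩ := hy
    exact hD ⟨r0, r1, r, r3, c0, c1, g, c3, e0, e1, hg, e3, by omega⟩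
  | 3 =>
    obtain ⟨r0, r1, r2, c0, c1, c2, e0, e1, e2, h⟩ := hx
    exact hD ⟨r0, r1, r2, r, c0, c1, c2, g, e0, e1, e2, hg, by omega⟩
  | 4 =>
    obtain ⟨r1, r2, r3, b, a', c, e1, e2, e3, h⟩ := hz
    by_cases hb : b < g'
    · exact hP ⟨r, r1, r2, r3, g', b, a', c, hg', e1, e2, e3, by omega⟩
    · exact hD ⟨r, r1, r2, r3, g, b, a', c, hg, e1, e2, e3, by omega⟩
  | 5 =>
    obtain ⟨r0, r2, r3, a, a', c, e0, e2, e3, h⟩ := hy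
    exact hP ⟨r0, r, r2, r3, a, g, a', c, e0, hg, e2, e3, by omega⟩
  | 6 =>
    obtain ⟨r0, r1, r3, a, b, c, e0, e1, e3, h⟩ := hx
    obtain ⟨_, _, r3', _, _, c', _, _, e3', h'⟩ := hy
    by_cases hc : g < c
    · exact hP ⟨r0, r1, r, r3, a, b, g, c, e0, e1, hg, e3, by omega⟩
    · exact hP ⟨r0, r1, r, r3', a, b, g, c', e0, e1, hg, e3', by omega⟩
  | 7 =>
    obtain ⟨r0, r1, r2, a, b, a', e0, e1, e2, h⟩ := hx
    exact hP ⟨r0, r1, r2, r, a, b, a', g, e0, e1, e2, hg, by omega⟩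
  | (n + 8) => exact hx

theorem rowBounded : RowBounded (AvF {D 4, P18}) := by
  refine ⟨16, fun M hM r hr => ?_⟩
  unfold rowRunCount
  set S := {j | j < M.n ∧ M.entry r j = false ∧ (j = 0 ∨ M.entry r (j - 1) = true)} with hS
  have hfin : S.Finite := (Set.finite_lt_nat M.n).subset fun x hx => hx.1
  have hone : ∀ x y, x ∈ S → y ∈ S → x < y → ∃ g, E M r g ∧ x < g ∧ g < y := by
    rintro x y ⟨_, hx, _⟩ ⟨hy1, _, hy⟩ hxy
    have hy : M.entry r (y - 1) = true := hy.resolve_left (by omega)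
    refine ⟨y - 1, ⟨hr, by omega, hy⟩, ?_, by omega⟩
    have : x ≠ y - 1 := by
      rintro rfl
      rw [hx] at hy
      exact absurd hy (by decide)
    omega
  have hsub : S ⊆ ⋃ t ∈ Finset.range 8, {x | x ∈ S ∧ Role M r x t} := by
    intro x hx
    obtain ⟨t, ht, h⟩ := exists_role hM.1 (hM.2 r x hr hx.1 hx.2.1)
    simp only [Set.mem_iUnion, Finset.mem_range]
    exact ⟨t, ht, hx, h⟩
  have hb : ∀ t, {x | x ∈ S ∧ Role M r x t}.ncard ≤ 2 := by
    intro t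
    refine ncard_le_two (hfin.subset fun x hx => hx.1) ?_
    rintro x y z ⟨hx, rx⟩ ⟨hy, ry⟩ ⟨hz, rz⟩ hxy hyz
    obtain ⟨g, eg, g1, g2⟩ := hone x y hx hy hxy
    obtain ⟨g', eg', g1', g2'⟩ := hone y z hy hz hyz
    exact role_three hM.1 eg eg' g1 g2 g1' g2' rx ry rz
  calc S.ncard ≤ _ := Set.ncard_le_ncard hsub (Set.Finite.subset hfin (by
        intro x hx
        simp only [Set.mem_iUnion] at hx
        obtain ⟨_, _, hx, _⟩ := hx
        exact hx))
    _ ≤ ∑ t ∈ Finset.range 8, {x | x ∈ S ∧ Role M r x t}.ncard :=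
        Finset.set_ncard_biUnion_le _ _
    _ ≤ ∑ t ∈ Finset.range 8, 2 := Finset.sum_le_sum fun t _ => hb t
    _ = 16 := by simp

end BMat

open BMat

/-- **Proposition (pro-counter).** For `F = {D₄, P}` with `P` the 4×3 pattern
with support `{(1,2),(2,1),(3,2),(4,3)}`, the class `Av(F)` is row-bounded
but not column-bounded. -/
theorem stmt_18 :
    RowBounded (AvF {D 4, P18}) ∧ ¬ ColBounded (AvF {D 4, P18}) := by
  exact ⟨rowBounded, not_colBounded⟩
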